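/- Let A ⊆ B ⊆ ℕ^m be positive affine semigroups with C(A) = C(B), and let K be a field. Then the rank of K[B] as a module over the integral domain K[A] — that is, the dimension over the fraction field Frac(K[A]) of the base change Frac(K[A]) ⊗_{K[A]} K[B] — equals the (finite) cardinality of the quotient group G(B)/G(A). -/

import Mathlib

open Pointwise

noncomputable section

/-- Coordinatewise cast `ℕ^m → ℚ^m`. -/
def natCastQ {m : ℕ} (x : Fin m → ℕ) : Fin m → ℚ := fun i => (x i : ℚ)

/-- Coordinatewise cast `ℕ^m → ℤ^m`. -/
def natCastZ {m : ℕ} (x : Fin m → ℕ) : Fin m → ℤ := fun i => (x i : ℤ)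

/-- Coordinatewise cast `ℤ^m → ℚ^m`. -/
def intCastQ {m : ℕ} (x : Fin m → ℤ) : Fin m → ℚ := fun i => (x i : ℚ)

/-- The rational convex cone spanned by a subset of `ℕ^m` inside `ℚ^m`. -/
def ratCone {m : ℕ} (X : Set (Fin m → ℕ)) : Set (Fin m → ℚ) :=
  {y | ∃ (k : ℕ) (q : Fin k → ℚ) (x : Fin k → (Fin m → ℕ)),
    (∀ i, 0 ≤ q i) ∧ (∀ i, x i ∈ X) ∧ y = ∑ i, q i • natCastQ (x i)}

/-- `B_A = {x ∈ B : x ∉ B + (A ∖ {0})}`. -/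
def BA {m : ℕ} (A B : AddSubmonoid (Fin m → ℕ)) : Set (Fin m → ℕ) :=
  {x | x ∈ B ∧ x ∉ (B : Set (Fin m → ℕ)) + ((A : Set (Fin m → ℕ)) \ {0})}

/-- The subgroup of `ℤ^m` generated by a subset of `ℕ^m`. -/
def grpZ {m : ℕ} (X : Set (Fin m → ℕ)) : AddSubgroup (Fin m → ℤ) :=
  AddSubgroup.closure (natCastZ '' X)

section Cone

variable {m : ℕ}

/-- The coordinatewise cast `ℕ^m → ℤ^m` as an additive homomorphism. -/
def natCastZHom : (Fin m → ℕ) →+ (Fin m → ℤ) where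
  toFun := natCastZ
  map_zero' := by ext i; simp [natCastZ]
  map_add' x y := by ext i; simp [natCastZ]

lemma natCastZ_injective : Function.Injective (natCastZ : (Fin m → ℕ) → (Fin m → ℤ)) := by
  intro x y h
  ext i
  exact Nat.cast_injective (R := ℤ) (congrFun h i)

lemma natCastZ_add (x y : Fin m → ℕ) : natCastZ (x + y) = natCastZ x + natCastZ y :=
  map_add natCastZHom x y

lemma natCastZ_nsmul (n : ℕ) (x : Fin m → ℕ) : natCastZ (n • x) = n • natCastZ x :=
  map_nsmul natCastZHom n x

lemma natCastZ_mem_grpZ {X : Set (Fin m → ℕ)} {x : Fin m → ℕ} (hx : x ∈ X) :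
    natCastZ x ∈ grpZ X :=
  AddSubgroup.subset_closure ⟨x, hx, rfl⟩

/-- The group generated by a submonoid consists of differences of elements of the submonoid. -/
lemma mem_grpZ_iff (A : AddSubmonoid (Fin m → ℕ)) (x : Fin m → ℤ) :
    x ∈ grpZ (A : Set (Fin m → ℕ)) ↔ ∃ a ∈ A, ∃ a' ∈ A, x = natCastZ a - natCastZ a' := by
  constructor
  · intro hx
    induction hx using AddSubgroup.closure_induction with
    | mem x hx =>
      obtain ⟨a, ha, rfl⟩ := hx
      exact ⟨a, ha, 0, A.zero_mem, by ext i; simp [natCastZ]⟩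
    | zero => exact ⟨0, A.zero_mem, 0, A.zero_mem, by simp⟩
    | add x y _ _ ihx ihy =>
      obtain ⟨a, ha, a', ha', rfl⟩ := ihx
      obtain ⟨c, hc, c', hc', rfl⟩ := ihy
      refine ⟨a + c, A.add_mem ha hc, a' + c', A.add_mem ha' hc', ?_⟩
      rw [natCastZ_add, natCastZ_add]
      abel
    | neg x _ ih =>
      obtain ⟨a, ha, a', ha', rfl⟩ := ih
      exact ⟨a', ha', a, ha, by abel⟩
  · rintro ⟨a, ha, a', ha', rfl⟩
    exact sub_mem (natCastZ_mem_grpZ ha) (natCastZ_mem_grpZ ha')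

/-- A lattice point of the rational cone of `A` has a positive multiple in `A`. -/
lemma exists_nsmul_mem_of_mem_ratCone (A : AddSubmonoid (Fin m → ℕ)) {b : Fin m → ℕ}
    (hb : natCastQ b ∈ ratCone (A : Set (Fin m → ℕ))) : ∃ N : ℕ, 0 < N ∧ N • b ∈ A := by
  obtain ⟨k, q, x, hq, hx, hsum⟩ := hb
  refine ⟨∏ i, (q i).den, Finset.prod_pos fun i _ => (q i).pos, ?_⟩
  have key : ∀ i, ∃ n : ℕ, ((∏ j, (q j).den : ℕ) : ℚ) * q i = n := by
    intro i
    refine ⟨(∏ j ∈ Finset.univ.erase i, (q j).den) * (q i).num.toNat, ?_⟩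
    rw [← Finset.prod_erase_mul _ _ (Finset.mem_univ i)]
    have h1 : (((q i).num.toNat : ℕ) : ℚ) = (q i).num := by
      exact_mod_cast Int.toNat_of_nonneg (Rat.num_nonneg.mpr (hq i))
    rw [Nat.cast_mul, Nat.cast_mul, h1, mul_assoc, Rat.den_mul_eq_num]
  choose n hn using key
  have : (∏ i, (q i).den) • b = ∑ i, n i • x i := by
    ext j
    have h := congrFun hsum j
    simp only [natCastQ, Finset.sum_apply, Pi.smul_apply, smul_eq_mul] at h ⊢
    have h2 : (((∏ i, (q i).den : ℕ) * b j : ℕ) : ℚ) = ((∑ i, n i * x i j : ℕ) : ℚ) := by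
      rw [Nat.cast_mul, h, Finset.mul_sum, Nat.cast_sum]
      refine Finset.sum_congr rfl fun i _ => ?_
      rw [Nat.cast_mul, ← hn i]
      ring
    exact_mod_cast h2
  rw [this]
  exact A.sum_mem fun i _ => A.nsmul_mem (hx i) _

lemma natCastQ_mem_ratCone {X : Set (Fin m → ℕ)} {x : Fin m → ℕ} (hx : x ∈ X) :
    natCastQ x ∈ ratCone X :=
  ⟨1, fun _ => 1, fun _ => x, by simp, by simpa using hx, by simp⟩

/-- If every element of `B` has a positive multiple in `A`, then `G(B)/G(A)` is finite. -/
lemma finite_grpZ_quotient (A B : AddSubmonoid (Fin m → ℕ))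
    (h : ∀ b ∈ B, ∃ N : ℕ, 0 < N ∧ N • b ∈ A) :
    Finite (grpZ (B : Set (Fin m → ℕ)) ⧸
      (grpZ (A : Set (Fin m → ℕ))).addSubgroupOf (grpZ (B : Set (Fin m → ℕ)))) := by
  have : Module.Finite ℤ (grpZ (B : Set (Fin m → ℕ))) :=
    inferInstanceAs (Module.Finite ℤ
      (AddSubgroup.toIntSubmodule (grpZ (B : Set (Fin m → ℕ)))))
  have : Module.Finite ℤ (grpZ (B : Set (Fin m → ℕ)) ⧸
      (grpZ (A : Set (Fin m → ℕ))).addSubgroupOf (grpZ (B : Set (Fin m → ℕ)))) :=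
    Module.Finite.of_surjective (QuotientAddGroup.mk' _).toIntLinearMap
      (QuotientAddGroup.mk'_surjective _)
  refine Module.finite_of_fg_torsion _ ?_
  rintro ⟨x, hx⟩
  obtain ⟨b, hb, b', hb', rfl⟩ := (mem_grpZ_iff B x).mp hx
  obtain ⟨N, hN, hNA⟩ := h b hb
  obtain ⟨N', hN', hNA'⟩ := h b' hb'
  refine ⟨⟨((N * N' : ℕ) : ℤ), mem_nonZeroDivisors_of_ne_zero (by positivity)⟩, ?_⟩
  change ((N * N' : ℕ) : ℤ) • (QuotientAddGroup.mk ⟨natCastZ b - natCastZ b', hx⟩ :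
    grpZ (B : Set (Fin m → ℕ)) ⧸
      (grpZ (A : Set (Fin m → ℕ))).addSubgroupOf (grpZ (B : Set (Fin m → ℕ)))) = 0
  rw [natCast_zsmul, ← QuotientAddGroup.mk_nsmul, QuotientAddGroup.eq_zero_iff,
    AddSubgroup.mem_addSubgroupOf, mem_grpZ_iff]
  refine ⟨N' • (N • b), A.nsmul_mem hNA _, N • (N' • b'), A.nsmul_mem hNA' _, ?_⟩
  simp only [natCastZ_nsmul, AddSubgroup.coe_nsmul, nsmul_sub, smul_smul]
  rw [mul_comm N' N]

end Cone

section Rank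

open AddMonoidAlgebra

lemma single_one_mem_nonZeroDivisors (K : Type*) [Field K] {A : Type*} [AddCommMonoid A]
    [IsCancelAdd A] (a : A) :
    (single a 1 : AddMonoidAlgebra K A) ∈ nonZeroDivisors (AddMonoidAlgebra K A) := by
  refine mem_nonZeroDivisors_iff_right.mpr fun x hx => ?_
  ext c
  have h := congrArg (fun y : AddMonoidAlgebra K A => y.coeff (c + a)) hx
  have h2 : (x * single a 1).coeff (c + a) = x.coeff c * 1 :=
    coeff_mul_single_eq_coeff_mul _ (by simp)
  simpa [h2] using h

variable {K A B Q : Type*} [Field K] [AddCommMonoid A] [AddCommMonoid B] [IsCancelAdd B]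
  [AddCommGroup Q]

/-- Monomials whose exponents lie in distinct fibres of `φ : B → Q` are linearly independent
over `K[A]` as soon as `φ` kills `A`. -/
lemma linearIndependent_single_section (i : A →+ B) (hi : Function.Injective i) (φ : B →+ Q)
    (hφi : ∀ a, φ (i a) = 0) (s : Q → B) (hs : ∀ q, φ (s q) = q) :
    letI := (AddMonoidAlgebra.mapDomainRingHom K i).toModule
    LinearIndependent (AddMonoidAlgebra K A)
      (fun q => (single (s q) 1 : AddMonoidAlgebra K B)) := by
  let _ := (AddMonoidAlgebra.mapDomainRingHom K i).toModule
  change LinearIndependent (AddMonoidAlgebra K A) _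
  rw [linearIndependent_iff']
  intro t g hg q hq
  ext a
  have h := congrArg (fun y : AddMonoidAlgebra K B => y.coeff (i a + s q)) hg
  simp only [coeff_sum, Finsupp.finsetSum_apply, coeff_zero, Finsupp.coe_zero,
    Pi.zero_apply] at h
  have smul_def : ∀ q', (g q' • (single (s q') 1 : AddMonoidAlgebra K B)) =
    mapDomain i (g q') * single (s q') 1 := fun _ => rfl
  rw [Finset.sum_eq_single q] at h
  · rw [smul_def, coeff_mul_single_eq_coeff_mul (i a) (by simp)] at h
    rw [coeff_mapDomain, Finsupp.mapDomain_apply hi, mul_one] at h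
    simpa using h
  · intro q' _ hne
    rw [smul_def]
    induction g q' using AddMonoidAlgebra.induction_linear with
    | zero => simp
    | add x y hx hy =>
      rw [mapDomain_add, add_mul, coeff_add, Finsupp.add_apply, hx, hy, add_zero]
    | single c k =>
      rw [mapDomain_single, single_mul_single, coeff_single]
      refine Finsupp.single_eq_of_ne fun h => hne ?_
      simpa [hφi, hs] using (congrArg φ h).symm
  · exact fun h => (h hq).elim

open TensorProduct in
/-- If `φ : B → Q` is surjective and identifies exactly the elements of `B` that differ by elements
of `A`, then `K[B]` has rank `#Q` over `K[A]`. -/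
theorem rank_fractionRing_tensorProduct_eq_card [IsCancelAdd A] [Finite Q] (i : A →+ B)
    (hi : Function.Injective i) (φ : B →+ Q) (hφ : Function.Surjective φ)
    (hker : ∀ b b', φ b = φ b' ↔ ∃ a a', b + i a' = b' + i a) :
    letI := (AddMonoidAlgebra.mapDomainRingHom K i).toModule
    Module.rank (FractionRing (AddMonoidAlgebra K A))
        (FractionRing (AddMonoidAlgebra K A) ⊗[AddMonoidAlgebra K A] AddMonoidAlgebra K B) =
      Nat.card Q := by
  let _ := (AddMonoidAlgebra.mapDomainRingHom K i).toModule
  change Module.rank (FractionRing (AddMonoidAlgebra K A))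
    (FractionRing (AddMonoidAlgebra K A) ⊗[AddMonoidAlgebra K A] AddMonoidAlgebra K B) = _
  have smul_def : ∀ (x : AddMonoidAlgebra K A) (y : AddMonoidAlgebra K B),
    x • y = mapDomain i x * y := fun _ _ => rfl
  obtain ⟨s, hs⟩ := hφ.hasRightInverse
  have hφi : ∀ a, φ (i a) = 0 := fun a => by
    rw [← map_zero φ, hker]
    exact ⟨a, 0, by simp⟩
  have hli := (linearIndependent_single_section (K := K) i hi φ hφi s hs).of_isLocalizedModule
    (FractionRing (AddMonoidAlgebra K A)) (nonZeroDivisors (AddMonoidAlgebra K A))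
    (TensorProduct.mk (AddMonoidAlgebra K A) (FractionRing (AddMonoidAlgebra K A))
      (AddMonoidAlgebra K B) 1)
  have hspan : ⊤ ≤ Submodule.span (FractionRing (AddMonoidAlgebra K A))
      (Set.range (TensorProduct.mk (AddMonoidAlgebra K A) (FractionRing (AddMonoidAlgebra K A))
        (AddMonoidAlgebra K B) 1 ∘ fun q => (single (s q) 1 : AddMonoidAlgebra K B))) := by
    rintro z -
    induction z with
    | zero => exact Submodule.zero_mem _
    | add x y hx hy => exact Submodule.add_mem _ hx hy
    | tmul f x =>
      induction x using AddMonoidAlgebra.induction_linear with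
      | zero => simp
      | add x y hx hy => rw [TensorProduct.tmul_add]; exact Submodule.add_mem _ hx hy
      | single b k =>
        obtain ⟨a, a', h⟩ := (hker b (s (φ b))).mp (hs (φ b)).symm
        obtain ⟨g, rfl⟩ : ∃ g, (single a' 1 : AddMonoidAlgebra K A) • g = f := by
          have hu := IsLocalization.map_units (FractionRing (AddMonoidAlgebra K A))
            (⟨_, single_one_mem_nonZeroDivisors K a'⟩ : nonZeroDivisors (AddMonoidAlgebra K A))
          obtain ⟨u, hu⟩ := hu
          refine ⟨↑u⁻¹ * f, ?_⟩
          rw [Algebra.smul_def, ← mul_assoc, ← hu, Units.mul_inv, one_mul]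
        have hx : (single a' 1 : AddMonoidAlgebra K A) • (single b k : AddMonoidAlgebra K B) =
            (single a k : AddMonoidAlgebra K A) • single (s (φ b)) 1 := by
          rw [smul_def, smul_def, mapDomain_single, mapDomain_single, single_mul_single,
            single_mul_single, add_comm, h, add_comm, one_mul, mul_one]
        rw [TensorProduct.smul_tmul, hx, ← TensorProduct.smul_tmul, ← mul_one (_ • g),
          ← smul_eq_mul, ← TensorProduct.smul_tmul']
        exact Submodule.smul_mem _ _ (Submodule.subset_span ⟨φ b, rfl⟩)
  have := Fintype.ofFinite Q
  rw [rank_eq_card_basis (Module.Basis.mk hli hspan), Nat.card_eq_fintype_card]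

end Rank

open TensorProduct in
/-- The rank of `K[B]` as a module over the domain `K[A]`, i.e. the dimension
over `Frac(K[A])` of `Frac(K[A]) ⊗_{K[A]} K[B]`, equals the cardinality of `G(B)/G(A)`. -/
theorem rank_eq_card_quotient {m : ℕ} (K : Type*) [Field K]
    (A B : AddSubmonoid (Fin m → ℕ)) (hAB : A ≤ B) (hA : A.FG) (hB : B.FG)
    (hC : ratCone (A : Set (Fin m → ℕ)) = ratCone (B : Set (Fin m → ℕ))) :
    letI := (AddMonoidAlgebra.mapDomainRingHom K (AddSubmonoid.inclusion hAB)).toModule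
    Module.rank (FractionRing (AddMonoidAlgebra K A))
        (FractionRing (AddMonoidAlgebra K A) ⊗[AddMonoidAlgebra K A] AddMonoidAlgebra K B) =
      Nat.card (grpZ (B : Set (Fin m → ℕ)) ⧸
        (grpZ (A : Set (Fin m → ℕ))).addSubgroupOf (grpZ (B : Set (Fin m → ℕ)))) := by
  have hmul : ∀ b ∈ B, ∃ N : ℕ, 0 < N ∧ N • b ∈ A := fun b hb =>
    exists_nsmul_mem_of_mem_ratCone A (hC ▸ natCastQ_mem_ratCone hb)
  have := finite_grpZ_quotient A B hmul
  let ψ : B →+ grpZ (B : Set (Fin m → ℕ)) :=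
    (natCastZHom.comp B.subtype).codRestrict _ fun b => natCastZ_mem_grpZ b.2
  have hψ : ∀ b, (ψ b : Fin m → ℤ) = natCastZ b := fun _ => rfl
  have hsurj : Function.Surjective ((QuotientAddGroup.mk'
      ((grpZ (A : Set (Fin m → ℕ))).addSubgroupOf (grpZ (B : Set (Fin m → ℕ))))).comp ψ) := by
    intro q
    obtain ⟨⟨x, hx⟩, rfl⟩ := QuotientAddGroup.mk_surjective q
    obtain ⟨b, hb, b', hb', rfl⟩ := (mem_grpZ_iff B x).mp hx
    obtain ⟨N, hN, hNA⟩ := hmul b' hb'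
    refine ⟨⟨b + (N - 1) • b', B.add_mem hb (B.nsmul_mem hb' _)⟩, ?_⟩
    simp only [AddMonoidHom.comp_apply, QuotientAddGroup.mk'_apply]
    rw [eq_comm, QuotientAddGroup.eq, AddSubgroup.mem_addSubgroupOf, mem_grpZ_iff]
    refine ⟨N • b', hNA, 0, A.zero_mem, ?_⟩
    obtain ⟨n, rfl⟩ := Nat.exists_eq_add_of_lt hN
    ext j
    simp [hψ, natCastZ]
    ring
  have hker : ∀ b b', (QuotientAddGroup.mk' ((grpZ (A : Set (Fin m → ℕ))).addSubgroupOf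
      (grpZ (B : Set (Fin m → ℕ))))).comp ψ b = (QuotientAddGroup.mk'
        ((grpZ (A : Set (Fin m → ℕ))).addSubgroupOf (grpZ (B : Set (Fin m → ℕ))))).comp ψ b' ↔
      ∃ a a', b + AddSubmonoid.inclusion hAB a' = b' + AddSubmonoid.inclusion hAB a := by
    intro b b'
    simp only [AddMonoidHom.comp_apply, QuotientAddGroup.mk'_apply]
    rw [eq_comm, QuotientAddGroup.eq, AddSubgroup.mem_addSubgroupOf, mem_grpZ_iff]
    simp only [AddSubgroup.coe_add, AddSubgroup.coe_neg, hψ]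
    constructor
    · rintro ⟨a, ha, a', ha', h⟩
      refine ⟨⟨a, ha⟩, ⟨a', ha'⟩, Subtype.ext (natCastZ_injective ?_)⟩
      simp only [AddSubmonoid.coe_add, AddSubmonoid.coe_inclusion, natCastZ_add]
      linear_combination (exp := 1) h
    · rintro ⟨a, a', h⟩
      refine ⟨a, a.2, a', a'.2, ?_⟩
      have h2 := congrArg (fun y : B => natCastZ (y : Fin m → ℕ)) h
      simp only [AddSubmonoid.coe_add, AddSubmonoid.coe_inclusion, natCastZ_add] at h2
      linear_combination (exp := 1) h2
  exact rank_fractionRing_tensorProduct_eq_card (AddSubmonoid.inclusion hAB)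
    (AddSubmonoid.inclusion_injective hAB) _ hsurj hker
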